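/- arXiv:2411.19267 — 3 statements merged into one kernel-verified Lean document; each statement's English description precedes it below -/
import Mathlib

section
/- For every integer r ≥ 3 there exists an integer M such that for every integer m ≥ M: every (r,r)-system (H,F) with |H| = m satisfies |F| ≤ ⌊(m-r+2)/2⌋, and there exists an (r,r)-system (H,F) with |H| = m and |F| = ⌊(m-r+2)/2⌋. -/
open SimpleGraph

/-- `G` is `K_r`-saturated: `G` contains no `r`-clique, but adding any missing edge
creates an `r`-clique. -/
def Ksat (r : ℕ) {V : Type*} (G : SimpleGraph V) : Prop :=
  G.CliqueFree r ∧ ∀ u v : V, u ≠ v → ¬ G.Adj u v →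
    ¬ (G ⊔ fromEdgeSet {s(u, v)}).CliqueFree r

/-- `G` is twin-free: distinct vertices have distinct neighbourhoods. -/
def TwinFree {V : Type*} (G : SimpleGraph V) : Prop :=
  ∀ u v : V, G.neighborSet u = G.neighborSet v → u = v

/-- Minimum degree of `G` is at least `t`. -/
def MinDegGe {V : Type*} (G : SimpleGraph V) (t : ℕ) : Prop :=
  ∀ v : V, t ≤ (G.neighborSet v).ncard

/-- Every pair of distinct twins has a common neighbour of degree exactly `t`. -/
def TwinCond {V : Type*} (G : SimpleGraph V) (t : ℕ) : Prop :=
  ∀ u v : V, u ≠ v → G.neighborSet u = G.neighborSet v →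
    ∃ w : V, (G.neighborSet w).ncard = t ∧ G.Adj w u ∧ G.Adj w v

/-- An `(r,t)`-system. -/
def IsRTSystem (r t : ℕ) {V : Type*} [DecidableEq V] (H : SimpleGraph V)
    (F : Finset (Finset V)) : Prop :=
  H.CliqueFree r ∧
  (∀ S ∈ F, S.card = t ∧
    (H.induce (S : Set V)).CliqueFree (r - 1) ∧
    ∀ v : V, v ∉ S → ¬ (H.induce ((insert v S : Finset V) : Set V)).CliqueFree (r - 1)) ∧
  (∀ S ∈ F, ∀ T ∈ F, S ≠ T → ¬ (H.induce ((S ∩ T : Finset V) : Set V)).CliqueFree (r - 2))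

/-- A maximal `(r,t)`-system. -/
def IsMaxRTSystem (r t : ℕ) {V : Type*} [DecidableEq V] (H : SimpleGraph V)
    (F : Finset (Finset V)) : Prop :=
  IsRTSystem r t H F ∧
  ∀ u v : V, u ≠ v → ¬ H.Adj u v →
    ¬ (H ⊔ fromEdgeSet {s(u, v)}).CliqueFree r ∨
    ∃ S ∈ F, ¬ (((H ⊔ fromEdgeSet {s(u, v)}).induce (S : Set V)).CliqueFree (r - 1))

/-- A `(3,t)`-system. -/
def Is3TSystem (t : ℕ) {V : Type*} [DecidableEq V] (H : SimpleGraph V)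
    (F : Finset (Finset V)) : Prop :=
  H.CliqueFree 3 ∧
  (∀ S ∈ F, S.card = t ∧
    (∀ u ∈ S, ∀ v ∈ S, ¬ H.Adj u v) ∧
    (∀ v : V, v ∉ S → ∃ u ∈ S, H.Adj v u)) ∧
  (∀ S ∈ F, ∀ T ∈ F, S ≠ T → (S ∩ T).Nonempty)

/-- A maximal `(3,t)`-system. -/
def IsMax3TSystem (t : ℕ) {V : Type*} [DecidableEq V] (H : SimpleGraph V)
    (F : Finset (Finset V)) : Prop :=
  Is3TSystem t H F ∧
  ∀ u v : V, u ≠ v → ¬ H.Adj u v →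
    ¬ (H ⊔ fromEdgeSet {s(u, v)}).CliqueFree 3 ∨ ∃ S ∈ F, u ∈ S ∧ v ∈ S

noncomputable def s3 (t m : ℕ) : ℕ :=
  sSup {a : ℕ | ∃ (H : SimpleGraph (Fin m)) (F : Finset (Finset (Fin m))),
    Is3TSystem t H F ∧ F.card = a}

noncomputable def ePrime (r t s : ℕ) : ℕ :=
  sInf {e : ℕ | ∃ (m : ℕ) (H : SimpleGraph (Fin m)) (F : Finset (Finset (Fin m))),
    IsMaxRTSystem r t H F ∧ F.card = s ∧ H.edgeSet.ncard = e}

noncomputable def e3min (t s : ℕ) : ℕ :=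
  sInf {e : ℕ | ∃ (m : ℕ) (H : SimpleGraph (Fin m)) (F : Finset (Finset (Fin m))),
    Is3TSystem t H F ∧ F.card = s ∧ H.edgeSet.ncard = e}

open Finset

section Auxiliary

variable {V : Type*} [DecidableEq V]

lemma eq_of_card_union_le_one {s t : Finset V} (hs : s.Nonempty) (ht : t.Nonempty)
    (h : (s ∪ t).card ≤ 1) : s = t := by
  have h1 := Finset.card_pos.2 hs
  have h2 := Finset.card_pos.2 ht
  exact (Finset.eq_of_subset_of_card_le Finset.subset_union_left (by omega)).trans
    (Finset.eq_of_subset_of_card_le Finset.subset_union_right (by omega)).symm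

lemma not_cliqueFree_induce_iff (H : SimpleGraph V) (S : Finset V) (k : ℕ) :
    ¬ (H.induce (S : Set V)).CliqueFree k ↔ ∃ K ⊆ S, H.IsNClique k K := by
  unfold SimpleGraph.CliqueFree
  push Not
  constructor
  · rintro ⟨t, ht⟩
    refine ⟨t.map (Function.Embedding.subtype _), ?_, ?_⟩
    · intro x hx
      obtain ⟨y, -, rfl⟩ := Finset.mem_map.1 hx
      exact y.2
    · refine ⟨?_, by simpa using ht.card_eq⟩
      intro x hx y hy hxy
      obtain ⟨x, hx', rfl⟩ := Finset.mem_map.1 hx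
      obtain ⟨y, hy', rfl⟩ := Finset.mem_map.1 hy
      exact ht.isClique hx' hy' (fun h => hxy (by rw [h]))
  · rintro ⟨K, hKS, hK⟩
    refine ⟨K.subtype (· ∈ (S : Set V)), ?_, ?_⟩
    · intro x hx y hy hxy
      exact hK.isClique (by simpa using hx) (by simpa using hy)
        (fun h => hxy (Subtype.ext h))
    · rw [Finset.card_subtype, Finset.filter_true_of_mem, hK.card_eq]
      exact fun x hx => hKS hx

/-- The conditions of an `(s+2,s+2)`-system, with cliques in induced subgraphs replaced by
cliques of the ambient graph. -/
structure CliqueSystem (s : ℕ) (H : SimpleGraph V) (F : Finset (Finset V)) : Prop where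
  cliqueFree : H.CliqueFree (s + 2)
  card_eq : ∀ S ∈ F, S.card = s + 2
  free : ∀ S ∈ F, ∀ K ⊆ S, ¬ H.IsNClique (s + 1) K
  dom : ∀ S ∈ F, ∀ v ∉ S, ∃ K ⊆ insert v S, H.IsNClique (s + 1) K
  inter : ∀ S ∈ F, ∀ T ∈ F, S ≠ T → ∃ K ⊆ S ∩ T, H.IsNClique s K

lemma isRTSystem_iff_cliqueSystem (s : ℕ) (H : SimpleGraph V) (F : Finset (Finset V)) :
    IsRTSystem (s + 2) (s + 2) H F ↔ CliqueSystem s H F := by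
  have key : ∀ (S : Finset V) (k : ℕ),
      (H.induce (S : Set V)).CliqueFree k ↔ ∀ K ⊆ S, ¬ H.IsNClique k K := by
    intro S k
    rw [← not_iff_not, not_cliqueFree_induce_iff]
    push Not
    rfl
  unfold IsRTSystem
  simp only [not_cliqueFree_induce_iff, Nat.add_sub_cancel, show s + 2 - 1 = s + 1 from rfl]
  simp only [key]
  constructor
  · rintro ⟨h0, h1, h2⟩
    exact ⟨h0, fun S hS => (h1 S hS).1, fun S hS => (h1 S hS).2.1, fun S hS => (h1 S hS).2.2, h2⟩
  · rintro ⟨h0, h1, h2, h3, h4⟩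
    exact ⟨h0, fun S hS => ⟨h1 S hS, h2 S hS, h3 S hS⟩, h4⟩

namespace CliqueSystem

variable {s : ℕ} {H : SimpleGraph V} {F : Finset (Finset V)}

lemma card_filter_superset_le (h : CliqueSystem s H F) (Z : Finset V) (hZ : Z.card = s + 1) :
    (F.filter (Z ⊆ ·)).card ≤ s + 1 := by
  set G := F.filter (Z ⊆ ·) with hG
  set P := (G.biUnion id) \ Z with hP
  have hins : ∀ p ∈ P, insert p Z ∈ F := by
    intro p hp
    simp only [hP, hG, mem_sdiff, mem_biUnion, mem_filter, id] at hp
    obtain ⟨⟨S, ⟨hS, hZS⟩, hpS⟩, hpZ⟩ := hp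
    have : insert p Z = S := by
      apply Finset.eq_of_subset_of_card_le (Finset.insert_subset hpS hZS)
      rw [Finset.card_insert_of_notMem hpZ, hZ, h.card_eq S hS]
    rwa [this]
  have hPZ : ∀ p ∈ P, p ∉ Z := fun p hp => (mem_sdiff.1 hp).2
  have hcl : H.IsClique (P : Set V) := by
    intro p hp q hq hpq
    have hqS : q ∉ insert p Z := by
      rw [Finset.mem_insert, not_or]
      exact ⟨hpq.symm, hPZ q hq⟩
    obtain ⟨K, hK, hKc⟩ := h.dom _ (hins p hp) q hqS
    have hqK : q ∈ K := by
      by_contra hn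
      exact h.free _ (hins p hp) K ((Finset.subset_insert_iff_of_notMem hn).1 hK) hKc
    have hpK : p ∈ K := by
      by_contra hn
      rw [Finset.insert_comm] at hK
      exact h.free _ (hins q hq) K ((Finset.subset_insert_iff_of_notMem hn).1 hK) hKc
    exact hKc.isClique hpK hqK hpq
  have hPc : P.card ≤ s + 1 := by
    by_contra hn
    obtain ⟨Q, hQ, hQc⟩ := Finset.exists_subset_card_eq (show s + 2 ≤ P.card by omega)
    exact h.cliqueFree Q ⟨hcl.subset hQ, hQc⟩
  refine le_trans ?_ hPc
  refine le_trans (Finset.card_le_card ?_) (Finset.card_image_le (s := P) (f := fun p => insert p Z))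
  intro S hS
  obtain ⟨hSF, hZS⟩ := Finset.mem_filter.1 hS
  obtain ⟨p, hp'⟩ : (S \ Z).Nonempty := by
    rw [← Finset.card_pos, Finset.card_sdiff_of_subset hZS, hZ, h.card_eq S hSF]
    omega
  obtain ⟨hpS', hp⟩ := mem_sdiff.1 hp'
  have hpS := Finset.insert_subset hpS' hZS
  refine Finset.mem_image.2 ⟨p, ?_, ?_⟩
  · exact mem_sdiff.2 ⟨mem_biUnion.2 ⟨S, hS, hpS (mem_insert_self _ _)⟩, hp⟩
  · apply Finset.eq_of_subset_of_card_le hpS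
    rw [Finset.card_insert_of_notMem hp, hZ, h.card_eq S hSF]

/-- If many members of the family contain `Y`, some member meets a given set `X` only inside
`Y`. -/
lemma exists_avoiding (h : CliqueSystem s H F) {Y : Finset V} (hY : Y.card = s) (X : Finset V)
    (hX : X.card * (s + 1) < (F.filter (Y ⊆ ·)).card) :
    ∃ S ∈ F, Y ⊆ S ∧ S ∩ X ⊆ Y := by
  by_contra! hn
  have hsub : F.filter (Y ⊆ ·) ⊆ (X \ Y).biUnion (fun x => F.filter (insert x Y ⊆ ·)) := by
    intro S hS
    obtain ⟨hSF, hYS⟩ := mem_filter.1 hS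
    obtain ⟨x, hx, hxY⟩ := Finset.not_subset.1 (hn S hSF hYS)
    obtain ⟨hxS, hxX⟩ := mem_inter.1 hx
    exact mem_biUnion.2 ⟨x, mem_sdiff.2 ⟨hxX, hxY⟩,
      mem_filter.2 ⟨hSF, Finset.insert_subset hxS hYS⟩⟩
  have h1 := Finset.card_le_card hsub
  have h2 : ((X \ Y).biUnion (fun x => F.filter (insert x Y ⊆ ·))).card ≤
      (X \ Y).card * (s + 1) := by
    apply Finset.card_biUnion_le_card_mul
    intro x hx
    apply h.card_filter_superset_le
    rw [Finset.card_insert_of_notMem (mem_sdiff.1 hx).2, hY]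
  have h3 : (X \ Y).card ≤ X.card := Finset.card_le_card Finset.sdiff_subset
  have := Nat.mul_le_mul_right (s + 1) h3
  omega

end CliqueSystem

/-- A set of links `E` on a vertex set `W` in a graph `H`, with vertices labelled by finite sets.
The axioms abstract the properties of pairs completing a clique `Y` to a member of a clique
system, where the label of a vertex is its set of non-neighbours in `Y`. -/
structure LinkSystem (H : SimpleGraph V) (W : V → Prop) (A : V → Finset V)
    (E : V → V → Prop) : Prop where
  symm : ∀ a b, E a b → E b a
  ne : ∀ a b, E a b → a ≠ b
  mem : ∀ a b, E a b → W a
  nonempty : ∀ a b, E a b → (A a).Nonempty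
  two_le : ∀ a b, E a b → H.Adj a b → 2 ≤ (A a ∪ A b).card
  dom : ∀ a b v, E a b → W v → v ≠ a → v ≠ b → (A v).Nonempty →
    (H.Adj v a ∧ (A v ∪ A a).card ≤ 1) ∨ (H.Adj v b ∧ (A v ∪ A b).card ≤ 1) ∨
    (H.Adj v a ∧ H.Adj v b ∧ H.Adj a b ∧ (A v ∪ A a ∪ A b).card ≤ 2)
  triangle : ∀ u v w, W u → W v → W w → H.Adj u v → H.Adj u w → H.Adj v w →
    2 ≤ (A u ∪ A v ∪ A w).card
  fourClique : ∀ t u v w, W t → W u → W v → W w → H.Adj t u → H.Adj t v → H.Adj t w →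
    H.Adj u v → H.Adj u w → H.Adj v w → 3 ≤ (A t ∪ A u ∪ A v ∪ A w).card
  avoid : ∀ X : Finset V, X.card ≤ 10 → ∃ a b, E a b ∧ a ∉ X ∧ b ∉ X

namespace LinkSystem

variable {H : SimpleGraph V} {W : V → Prop} {A : V → Finset V} {E : V → V → Prop}

lemma card_le_one (h : LinkSystem H W A E) {v : V} (hv : W v) : (A v).card ≤ 1 := by
  by_contra! hc
  have hne : (A v).Nonempty := Finset.card_pos.1 (by omega)
  have hedge : ∀ a b, E a b → v ≠ a → v ≠ b →
      H.Adj v a ∧ H.Adj v b ∧ H.Adj a b ∧ A a ⊆ A v ∧ A b ⊆ A v ∧ (A v).card = 2 := by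
    intro a b hab ha hb
    rcases h.dom a b v hab hv ha hb hne with ⟨-, h1⟩ | ⟨-, h1⟩ | ⟨h1, h2, h3, h4⟩
    · have := Finset.card_le_card (Finset.subset_union_left (s₁ := A v) (s₂ := A a)); omega
    · have := Finset.card_le_card (Finset.subset_union_left (s₁ := A v) (s₂ := A b)); omega
    · have h5 : A v ⊆ A v ∪ A a ∪ A b := fun x hx => by simp [hx]
      have h6 := Finset.card_le_card h5
      have h7 := Finset.eq_of_subset_of_card_le h5 (by omega)
      refine ⟨h1, h2, h3, ?_, ?_, by omega⟩ <;> rw [h7] <;> intro x hx <;> simp [hx]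
  have hB : ∀ B : Finset V, B ⊆ A v → B.card ≤ 2 := by
    obtain ⟨a, b, hab, ha, hb⟩ := h.avoid {v} (by simp)
    simp only [mem_singleton] at ha hb
    have := (hedge a b hab (Ne.symm ha) (Ne.symm hb)).2.2.2.2.2
    intro B hB
    exact this ▸ Finset.card_le_card hB
  have hcross : ∀ a b c d, E a b → E c d → v ≠ a → v ≠ b → v ≠ c → v ≠ d → c ≠ a → c ≠ b →
      (H.Adj c a ∧ (A c ∪ A a).card ≤ 1) ∨ (H.Adj c b ∧ (A c ∪ A b).card ≤ 1) := by
    intro a b c d hab hcd ha hb hc hd hca hcb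
    obtain ⟨e1, e2, e3, e4, e5, -⟩ := hedge a b hab ha hb
    obtain ⟨f1, f2, f3, f4, f5, -⟩ := hedge c d hcd hc hd
    rcases h.dom a b c hab (h.mem c d hcd) hca hcb (h.nonempty c d hcd) with h1 | h1 | h1
    · exact Or.inl h1
    · exact Or.inr h1
    · exfalso
      have h2 := h.fourClique v a b c hv (h.mem a b hab) (h.mem b a (h.symm a b hab))
        (h.mem c d hcd) e1 e2 f1 e3 h1.1.symm h1.2.1.symm
      have := hB (A v ∪ A a ∪ A b ∪ A c)
        (by simp only [Finset.union_subset_iff]; exact ⟨⟨⟨subset_rfl, e4⟩, e5⟩, f4⟩)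
      omega
  have heq : ∀ a c, (A a).Nonempty → (A c).Nonempty → (A c ∪ A a).card ≤ 1 → A a = A c :=
    fun a c ha hc hac => (eq_of_card_union_le_one hc ha hac).symm
  obtain ⟨a₁, b₁, E₁, ha₁, hb₁⟩ := h.avoid {v} (by simp)
  obtain ⟨a₂, b₂, E₂, ha₂, hb₂⟩ := h.avoid {v, a₁, b₁} (Finset.card_le_three.trans (by omega))
  obtain ⟨a₃, b₃, E₃, ha₃, hb₃⟩ := h.avoid {v, a₁, b₁, a₂, b₂}
    (Finset.card_le_five.trans (by omega))
  simp only [mem_singleton, mem_insert, not_or] at ha₁ hb₁ ha₂ hb₂ ha₃ hb₃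
  have hpick : ∀ a b, E a b → v ≠ a → v ≠ b → a ≠ a₁ → b ≠ a₁ →
      ∃ c d, E c d ∧ A c = A a₁ ∧ H.Adj a₁ c ∧ ((c = a ∧ d = b) ∨ (c = b ∧ d = a)) := by
    intro a b hab ha hb haa hba
    rcases hcross a b a₁ b₁ hab E₁ ha hb (Ne.symm ha₁) (Ne.symm hb₁) haa.symm hba.symm with
      h1 | h1
    · exact ⟨a, b, hab, heq _ _ (h.nonempty a b hab) (h.nonempty _ _ E₁) h1.2, h1.1, by simp⟩
    · exact ⟨b, a, h.symm _ _ hab,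
        heq _ _ (h.nonempty b a (h.symm _ _ hab)) (h.nonempty _ _ E₁) h1.2, h1.1, by simp⟩
  obtain ⟨c₂, d₂, hE₂, hA₂, hadj₂, hc₂⟩ :=
    hpick a₂ b₂ E₂ (Ne.symm ha₂.1) (Ne.symm hb₂.1) ha₂.2.1 hb₂.2.1
  obtain ⟨c₃, d₃, hE₃, hA₃, hadj₃, hc₃⟩ :=
    hpick a₃ b₃ E₃ (Ne.symm ha₃.1) (Ne.symm hb₃.1) ha₃.2.1 hb₃.2.1
  have hv₂ : v ≠ c₂ ∧ v ≠ d₂ := by grind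
  have hv₃ : v ≠ c₃ ∧ v ≠ d₃ := by grind
  have hne₃₂ : c₃ ≠ c₂ ∧ c₃ ≠ d₂ := by grind
  have hone : (A a₁).card ≤ 1 := by
    rcases hcross a₂ b₂ a₁ b₁ E₂ E₁ (Ne.symm ha₂.1) (Ne.symm hb₂.1) (Ne.symm ha₁) (Ne.symm hb₁)
      (Ne.symm ha₂.2.1) (Ne.symm hb₂.2.1) with h1 | h1
    · exact (Finset.card_le_card Finset.subset_union_left).trans h1.2
    · exact (Finset.card_le_card Finset.subset_union_left).trans h1.2
  have hadj₂₃ : H.Adj c₃ c₂ := by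
    rcases hcross c₂ d₂ c₃ d₃ hE₂ hE₃ hv₂.1 hv₂.2 hv₃.1 hv₃.2 hne₃₂.1 hne₃₂.2 with h1 | h1
    · exact h1.1
    · exfalso
      have h2 := heq _ _ (h.nonempty _ _ (h.symm _ _ hE₂)) (h.nonempty _ _ hE₃) h1.2
      have h3 := h.two_le c₂ d₂ hE₂ (hedge c₂ d₂ hE₂ hv₂.1 hv₂.2).2.2.1
      rw [h2, hA₃, hA₂, Finset.union_self] at h3
      omega
  have h2 := h.triangle a₁ c₂ c₃ (h.mem _ _ E₁) (h.mem _ _ hE₂) (h.mem _ _ hE₃) hadj₂ hadj₃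
    hadj₂₃.symm
  rw [hA₂, hA₃, Finset.union_self, Finset.union_self] at h2
  omega

lemma label_eq_of_card_union_le (h : LinkSystem H W A E) {a b v : V} (hab : E a b)
    (hne : (A v).Nonempty) (hc : (A v ∪ A a).card ≤ 1) : A v = A a :=
  eq_of_card_union_le_one hne (h.nonempty a b hab) hc

lemma label_ne_of_adj (h : LinkSystem H W A E) {a b : V} (hab : E a b) (hadj : H.Adj a b) :
    A a ≠ A b := by
  intro he
  have h1 := h.two_le a b hab hadj
  have h2 := h.card_le_one (h.mem a b hab)
  rw [← he, Finset.union_self] at h1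
  omega

lemma adj_and_label_eq (h : LinkSystem H W A E) {a b v : V} (hab : E a b) (hv : W v)
    (ha : v ≠ a) (hb : v ≠ b) (hne : (A v).Nonempty) :
    (H.Adj v a ∧ A v = A a) ∨ (H.Adj v b ∧ A v = A b) := by
  rcases h.dom a b v hab hv ha hb hne with ⟨h1, h2⟩ | ⟨h1, h2⟩ | ⟨h1, h2, h3, h4⟩
  · exact Or.inl ⟨h1, h.label_eq_of_card_union_le hab hne h2⟩
  · exact Or.inr ⟨h1, h.label_eq_of_card_union_le (h.symm _ _ hab) hne h2⟩
  · have h5 := h.two_le a b hab h3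
    have h6 : A a ∪ A b ⊆ A v ∪ A a ∪ A b := by
      intro x hx; simp only [mem_union] at hx ⊢; tauto
    have h7 := Finset.eq_of_subset_of_card_le h6 (by omega)
    obtain ⟨x, hx⟩ := hne
    have hx' : x ∈ A a ∪ A b := by rw [h7]; simp [hx]
    have huniq : ∀ u, W u → x ∈ A u → A v = A u := by
      intro u hu hxu
      have e1 : A v = {x} :=
        (Finset.eq_of_subset_of_card_le (Finset.singleton_subset_iff.2 hx)
          (by simpa using h.card_le_one hv)).symm
      have e2 : A u = {x} :=
        (Finset.eq_of_subset_of_card_le (Finset.singleton_subset_iff.2 hxu)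
          (by simpa using h.card_le_one hu)).symm
      rw [e1, e2]
    rcases mem_union.1 hx' with hx' | hx'
    · exact Or.inl ⟨h1, huniq a (h.mem _ _ hab) hx'⟩
    · exact Or.inr ⟨h2, huniq b (h.mem _ _ (h.symm _ _ hab)) hx'⟩

lemma not_triangle (h : LinkSystem H W A E) {u v w : V} (hu : W u) (hv : W v) (hw : W w)
    (huv : H.Adj u v) (huw : H.Adj u w) (hvw : H.Adj v w) (h1 : A v = A u) (h2 : A w = A u) :
    False := by
  have h3 := h.triangle u v w hu hv hw huv huw hvw
  have h4 := h.card_le_one hu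
  rw [h1, h2, Finset.union_self, Finset.union_self] at h3
  omega

lemma label_eq (h : LinkSystem H W A E) {a b : V} (hab : E a b) : A a = A b := by
  by_contra hne
  have hpick : ∀ c d, E c d → c ≠ a → c ≠ b → d ≠ a → d ≠ b →
      ∃ p q, E p q ∧ A p = A a ∧ A q = A b ∧ H.Adj a p ∧
        ((p = c ∧ q = d) ∨ (p = d ∧ q = c)) := by
    intro c d hcd hca hcb hda hdb
    have h1 := h.adj_and_label_eq hcd (h.mem _ _ hab) hca.symm hda.symm (h.nonempty _ _ hab)
    have h2 := h.adj_and_label_eq hcd (h.mem _ _ (h.symm _ _ hab)) hcb.symm hdb.symm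
      (h.nonempty _ _ (h.symm _ _ hab))
    rcases h1 with h1 | h1 <;> rcases h2 with h2 | h2
    · exact absurd (h1.2.trans h2.2.symm) hne
    · exact ⟨c, d, hcd, h1.2.symm, h2.2.symm, h1.1, by simp⟩
    · exact ⟨d, c, h.symm _ _ hcd, h1.2.symm, h2.2.symm, h1.1, by simp⟩
    · exact absurd (h1.2.trans h2.2.symm) hne
  obtain ⟨a₂, b₂, E₂, ha₂, hb₂⟩ := h.avoid {a, b} (Finset.card_le_two.trans (by omega))
  obtain ⟨a₃, b₃, E₃, ha₃, hb₃⟩ := h.avoid {a, b, a₂, b₂} (Finset.card_le_four.trans (by omega))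
  simp only [mem_singleton, mem_insert, not_or] at ha₂ hb₂ ha₃ hb₃
  obtain ⟨p, q, hpq, hp, hq, hap, hc⟩ := hpick a₂ b₂ E₂ ha₂.1 ha₂.2 hb₂.1 hb₂.2
  obtain ⟨u, w, huw, hu, hw, hau, hd⟩ := hpick a₃ b₃ E₃ ha₃.1 ha₃.2.1 hb₃.1 hb₃.2.1
  have hne' : u ≠ p ∧ u ≠ q := by grind
  rcases h.adj_and_label_eq hpq (h.mem _ _ huw) hne'.1 hne'.2 (h.nonempty _ _ huw) with h1 | h1
  · exact h.not_triangle (h.mem _ _ hab) (h.mem _ _ hpq) (h.mem _ _ huw) hap hau h1.1.symm hp hu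
  · exact hne (by rw [← hu, h1.2, hq])

lemma label_eq_label (h : LinkSystem H W A E) {u v : V} (hu : W u) (hv : W v)
    (hu' : (A u).Nonempty) (hv' : (A v).Nonempty) : A u = A v := by
  obtain ⟨a, b, hab, ha, hb⟩ := h.avoid {u, v} (Finset.card_le_two.trans (by omega))
  simp only [mem_singleton, mem_insert, not_or] at ha hb
  have h1 := h.adj_and_label_eq hab hu (Ne.symm ha.1) (Ne.symm hb.1) hu'
  have h2 := h.adj_and_label_eq hab hv (Ne.symm ha.2) (Ne.symm hb.2) hv'
  have h3 := h.label_eq hab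
  grind

/-- The links form a matching. -/
lemma unique (h : LinkSystem H W A E) {a b c : V} (hab : E a b) (hac : E a c) : b = c := by
  by_contra hbc
  have lab : ∀ {x y z w}, E x y → E z w → A x = A z := fun h1 h2 =>
    h.label_eq_label (h.mem _ _ h1) (h.mem _ _ h2) (h.nonempty _ _ h1) (h.nonempty _ _ h2)
  have nadj : ∀ {x y}, E x y → ¬ H.Adj x y := fun h1 h2 =>
    h.label_ne_of_adj h1 h2 (h.label_eq h1)
  have tri : ∀ {x x' y y' z z'}, E x x' → E y y' → E z z' → H.Adj x y → H.Adj x z →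
      H.Adj y z → False := fun h1 h2 h3 e1 e2 e3 =>
    h.not_triangle (h.mem _ _ h1) (h.mem _ _ h2) (h.mem _ _ h3) e1 e2 e3 (lab h2 h1) (lab h3 h1)
  have dom : ∀ {x y z w}, E x y → E z w → z ≠ x → z ≠ y → H.Adj z x ∨ H.Adj z y :=
    fun h1 h2 e1 e2 => (h.adj_and_label_eq h1 (h.mem _ _ h2) e1 e2 (h.nonempty _ _ h2)).imp
      And.left And.left
  have hcb : H.Adj c b :=
    (dom hab (h.symm _ _ hac) (h.ne _ _ hac).symm (Ne.symm hbc)).resolve_left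
      (fun e => nadj hac e.symm)
  have hadj : ∀ u w, E u w → u ≠ a → u ≠ b → u ≠ c → H.Adj u a := by
    intro u w huw h1 h2 h3
    by_contra hn
    have e1 := (dom hab huw h1 h2).resolve_left hn
    have e2 := (dom hac huw h1 h3).resolve_left hn
    exact tri huw (h.symm _ _ hac) (h.symm _ _ hab) e2 e1 hcb
  obtain ⟨u, w, huw, hu, hw⟩ := h.avoid {a, b, c} (Finset.card_le_three.trans (by omega))
  obtain ⟨x, y, hxy, hx, hy⟩ := h.avoid {a, b, c, u, w} (Finset.card_le_five.trans (by omega))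
  simp only [mem_singleton, mem_insert, not_or] at hu hw hx hy
  have e1 := hadj u w huw hu.1 hu.2.1 hu.2.2
  have e2 := hadj w u (h.symm _ _ huw) hw.1 hw.2.1 hw.2.2
  have e3 := hadj x y hxy hx.1 hx.2.1 hx.2.2.1
  rcases dom huw hxy hx.2.2.2.1 hx.2.2.2.2 with e | e
  · exact tri hxy huw hab e e3 e1
  · exact tri hxy (h.symm _ _ huw) hab e e3 e2

end LinkSystem

namespace CliqueSystem

variable {s : ℕ} {H : SimpleGraph V} {F : Finset (Finset V)}

open scoped Classical in
/-- The non-neighbours of `v` in `Y`. -/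
noncomputable def nonNbrs (H : SimpleGraph V) (Y : Finset V) (v : V) : Finset V :=
  Y.filter (fun y => ¬ H.Adj v y)

lemma mem_nonNbrs {V : Type*} {H : SimpleGraph V} {Y : Finset V} {v y : V} : y ∈ nonNbrs H Y v ↔ y ∈ Y ∧ ¬ H.Adj v y := by
  simp [nonNbrs]

lemma isNClique_sdiff_union {Y B C : Finset V} (hY : H.IsClique (Y : Set V))
    (hC : H.IsClique (C : Set V)) (hCY : ∀ c ∈ C, c ∉ Y)
    (hBC : ∀ c ∈ C, nonNbrs H Y c ⊆ B) :
    H.IsNClique ((Y \ B).card + C.card) ((Y \ B) ∪ C) := by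
  have hcross : ∀ c ∈ C, ∀ y ∈ Y \ B, H.Adj c y := by
    intro c hc y hy
    obtain ⟨hyY, hyB⟩ := mem_sdiff.1 hy
    by_contra hn
    exact hyB (hBC c hc (mem_nonNbrs.2 ⟨hyY, hn⟩))
  refine ⟨?_, Finset.card_union_of_disjoint ?_⟩
  · intro x hx y hy hxy
    rw [mem_coe, mem_union] at hx hy
    rcases hx with hx | hx <;> rcases hy with hy | hy
    · exact hY (mem_sdiff.1 hx).1 (mem_sdiff.1 hy).1 hxy
    · exact (hcross y hy x hx).symm
    · exact hcross x hx y hy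
    · exact hC hx hy hxy
  · rw [Finset.disjoint_right]
    exact fun c hc hc' => hCY c hc (mem_sdiff.1 hc').1

lemma exists_isNClique_subset {V : Type*} {H : SimpleGraph V} {k n : ℕ} {K : Finset V} (hK : H.IsNClique n K) (hkn : k ≤ n) :
    ∃ L ⊆ K, H.IsNClique k L := by
  obtain ⟨L, hL, hLc⟩ := Finset.exists_subset_card_eq (hK.card_eq ▸ hkn)
  exact ⟨L, hL, hK.isClique.subset hL, hLc⟩

lemma card_le_of_isClique (h : CliqueSystem s H F) {Y B C : Finset V} (hY : H.IsNClique s Y)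
    (hC : H.IsClique (C : Set V)) (hCY : ∀ c ∈ C, c ∉ Y)
    (hBC : ∀ c ∈ C, nonNbrs H Y c ⊆ B) : C.card ≤ B.card + 1 := by
  by_contra! hn
  have h1 := isNClique_sdiff_union hY.isClique hC hCY hBC
  have h2 := Finset.le_card_sdiff B Y
  rw [hY.card_eq] at h2
  obtain ⟨L, -, hL⟩ := exists_isNClique_subset h1 (show s + 2 ≤ _ by omega)
  exact h.cliqueFree L hL

lemma card_le_of_isClique_of_subset (h : CliqueSystem s H F) {Y B C S : Finset V}
    (hY : H.IsNClique s Y) (hS : S ∈ F) (hYS : Y ⊆ S) (hCS : C ⊆ S)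
    (hC : H.IsClique (C : Set V)) (hCY : ∀ c ∈ C, c ∉ Y)
    (hBC : ∀ c ∈ C, nonNbrs H Y c ⊆ B) : C.card ≤ B.card := by
  by_contra! hn
  have h1 := isNClique_sdiff_union hY.isClique hC hCY hBC
  have h2 := Finset.le_card_sdiff B Y
  rw [hY.card_eq] at h2
  obtain ⟨L, hLs, hL⟩ := exists_isNClique_subset h1 (show s + 1 ≤ _ by omega)
  exact h.free S hS L
    (hLs.trans (Finset.union_subset (Finset.sdiff_subset.trans hYS) hCS)) hL

lemma linkSystem (h : CliqueSystem s H F) {Y : Finset V} (hY : H.IsNClique s Y)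
    (hlarge : 10 * (s + 1) < (F.filter (Y ⊆ ·)).card) :
    LinkSystem H (· ∉ Y) (nonNbrs H Y)
      (fun a b => a ≠ b ∧ a ∉ Y ∧ b ∉ Y ∧ insert a (insert b Y) ∈ F) where
  symm a b := fun ⟨h1, h2, h3, h4⟩ => ⟨h1.symm, h3, h2, by rwa [Finset.insert_comm]⟩
  ne a b hab := hab.1
  mem a b hab := hab.2.1
  nonempty a b := by
    rintro ⟨h1, h2, h3, h4⟩
    have := h.card_le_of_isClique_of_subset hY h4 (C := {a}) (B := nonNbrs H Y a)
      (fun x hx => by simp [hx]) (by simp) (by simp) (by simpa using h2) (by simp)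
    rw [← Finset.card_pos]
    simpa using this
  two_le a b := by
    rintro ⟨h1, h2, h3, h4⟩ hadj
    have := h.card_le_of_isClique_of_subset hY h4 (C := {a, b})
      (B := nonNbrs H Y a ∪ nonNbrs H Y b)
      (fun x hx => by simp [hx]) (by grind) (by simp [hadj])
      (by grind) (by grind)
    rwa [Finset.card_pair h1] at this
  dom a b v := by
    rintro ⟨h1, h2, h3, h4⟩ hv hva hvb hne
    have hvS : v ∉ insert a (insert b Y) := by grind
    obtain ⟨K, hK, hKc⟩ := h.dom _ h4 v hvS
    have hvK : v ∈ K := by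
      by_contra hn
      exact h.free _ h4 K ((Finset.subset_insert_iff_of_notMem hn).1 hK) hKc
    have hsub : ∀ x ∈ K, x ∉ Y → nonNbrs H Y x ⊆ Y \ K := by
      intro x hx hxY y hy
      obtain ⟨hyY, hyn⟩ := mem_nonNbrs.1 hy
      refine mem_sdiff.2 ⟨hyY, fun hyK => hyn (hKc.isClique hx hyK ?_)⟩
      rintro rfl
      exact hxY hyY
    have hcard : (Y \ K).card + (s + 1) = s + (K \ Y).card := by
      have e1 := Finset.card_sdiff_add_card_inter Y K
      have e2 := Finset.card_sdiff_add_card_inter K Y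
      rw [Finset.inter_comm] at e2
      rw [hY.card_eq] at e1
      rw [hKc.card_eq] at e2
      omega
    by_cases haK : a ∈ K <;> by_cases hbK : b ∈ K
    · have e : K \ Y = {v, a, b} := by grind
      rw [e, Finset.card_eq_three.2 ⟨v, a, b, hva, hvb, h1, rfl⟩] at hcard
      refine Or.inr (Or.inr ⟨hKc.isClique hvK haK hva, hKc.isClique hvK hbK hvb,
        hKc.isClique haK hbK h1, ?_⟩)
      refine (Finset.card_le_card (Finset.union_subset (Finset.union_subset (hsub v hvK hv)
        (hsub a haK h2)) (hsub b hbK h3))).trans (by omega)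
    · have e : K \ Y = {v, a} := by grind
      rw [e, Finset.card_pair hva] at hcard
      refine Or.inl ⟨hKc.isClique hvK haK hva, ?_⟩
      exact (Finset.card_le_card (Finset.union_subset (hsub v hvK hv)
        (hsub a haK h2))).trans (by omega)
    · have e : K \ Y = {v, b} := by grind
      rw [e, Finset.card_pair hvb] at hcard
      refine Or.inr (Or.inl ⟨hKc.isClique hvK hbK hvb, ?_⟩)
      exact (Finset.card_le_card (Finset.union_subset (hsub v hvK hv)
        (hsub b hbK h3))).trans (by omega)
    · have e : K \ Y = {v} := by grind
      rw [e, Finset.card_singleton] at hcard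
      have := Finset.card_le_card (hsub v hvK hv)
      have := Finset.card_pos.2 hne
      omega
  triangle u v w hu hv hw huv huw hvw := by
    have := h.card_le_of_isClique hY (C := {u, v, w})
      (B := nonNbrs H Y u ∪ nonNbrs H Y v ∪ nonNbrs H Y w)
      (SimpleGraph.is3Clique_triple_iff.2 ⟨huv, huw, hvw⟩).isClique (by grind) (by grind)
    rw [(SimpleGraph.is3Clique_triple_iff.2 ⟨huv, huw, hvw⟩).card_eq] at this
    omega
  fourClique t u v w ht hu hv hw htu htv htw huv huw hvw := by
    have h4 : H.IsNClique 4 {t, u, v, w} :=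
      (SimpleGraph.is3Clique_triple_iff.2 ⟨huv, huw, hvw⟩).insert (by grind)
    have := h.card_le_of_isClique hY (C := {t, u, v, w})
      (B := nonNbrs H Y t ∪ nonNbrs H Y u ∪ nonNbrs H Y v ∪ nonNbrs H Y w)
      h4.isClique (by grind) (by grind)
    rw [h4.card_eq] at this
    omega
  avoid X hX := by
    obtain ⟨S, hS, hYS, hSX⟩ := h.exists_avoiding hY.card_eq X
      (lt_of_le_of_lt (Nat.mul_le_mul_right _ hX) hlarge)
    have hc : (S \ Y).card = 2 := by
      rw [Finset.card_sdiff_of_subset hYS, h.card_eq S hS, hY.card_eq]; omega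
    obtain ⟨a, b, hab, he⟩ := Finset.card_eq_two.1 hc
    have ha : a ∈ S \ Y := by simp [he]
    have hb : b ∈ S \ Y := by simp [he]
    have hS' : insert a (insert b Y) = S := by
      rw [← Finset.sdiff_union_of_subset hYS, he, Finset.insert_union, Finset.singleton_union]
    exact ⟨a, b, ⟨hab, by grind, by grind, by rwa [hS']⟩, by grind, by grind⟩

/-- If many members contain the clique `Y`, the whole family is a sunflower with kernel `Y`. -/
lemma two_mul_card_le [Fintype V] (h : CliqueSystem s H F) {Y : Finset V}
    (hY : H.IsNClique s Y) (hlarge : (s + 10) * (s + 1) < (F.filter (Y ⊆ ·)).card) :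
    2 * F.card ≤ Fintype.card V - s := by
  have hall : ∀ T ∈ F, Y ⊆ T := by
    intro T hT
    obtain ⟨S, hS, hYS, hST⟩ := h.exists_avoiding hY.card_eq T (by
      rw [h.card_eq T hT]
      exact lt_of_le_of_lt (Nat.mul_le_mul_right _ (by omega)) hlarge)
    by_cases hne : S = T
    · exact hne ▸ hYS
    · obtain ⟨K, hK, hKc⟩ := h.inter S hS T hT hne
      have : K = Y := Finset.eq_of_subset_of_card_le (hK.trans hST)
        (by rw [hKc.card_eq, hY.card_eq])
      exact this ▸ hK.trans Finset.inter_subset_right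
  have hL := h.linkSystem hY (lt_of_le_of_lt (Nat.mul_le_mul_right _ (by omega)) hlarge)
  have hcard : ∀ S ∈ F, (S \ Y).card = 2 := by
    intro S hS
    rw [Finset.card_sdiff_of_subset (hall S hS), h.card_eq S hS, hY.card_eq]; omega
  have hrep : ∀ S ∈ F, ∀ a ∈ S \ Y, ∃ b, S = insert a (insert b Y) ∧ a ≠ b ∧ b ∉ Y := by
    intro S hS a ha
    obtain ⟨p, q, hpq, he⟩ := Finset.card_eq_two.1 (hcard S hS)
    have hYS := hall S hS
    have hp : p ∈ S \ Y := by simp [he]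
    have hq : q ∈ S \ Y := by simp [he]
    have ha' := ha
    rw [he, mem_insert, mem_singleton] at ha'
    have hS' : S = insert p (insert q Y) := by
      rw [← Finset.sdiff_union_of_subset hYS, he, Finset.insert_union, Finset.singleton_union]
    rcases ha' with rfl | rfl
    · exact ⟨q, hS', hpq, (mem_sdiff.1 hq).2⟩
    · exact ⟨p, by rw [hS', Finset.insert_comm], hpq.symm, (mem_sdiff.1 hp).2⟩
  have hdisj : ∀ S ∈ F, ∀ T ∈ F, S ≠ T → Disjoint (S \ Y) (T \ Y) := by
    intro S hS T hT hne
    rw [Finset.disjoint_left]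
    intro a haS haT
    obtain ⟨b, hb, hab, hbY⟩ := hrep S hS a haS
    obtain ⟨c, hc, hac, hcY⟩ := hrep T hT a haT
    have haY := (mem_sdiff.1 haS).2
    have : b = c := hL.unique (a := a) ⟨hab, haY, hbY, hb ▸ hS⟩ ⟨hac, haY, hcY, hc ▸ hT⟩
    exact hne (by rw [hb, hc, this])
  calc 2 * F.card = ∑ S ∈ F, (S \ Y).card := by
        rw [Finset.sum_congr rfl hcard, Finset.sum_const, smul_eq_mul, mul_comm]
    _ = (F.biUnion (fun S => S \ Y)).card := (Finset.card_biUnion hdisj).symm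
    _ ≤ (Finset.univ \ Y).card := Finset.card_le_card (by
        intro x hx
        obtain ⟨S, -, hx⟩ := mem_biUnion.1 hx
        simpa using (mem_sdiff.1 hx).2)
    _ = Fintype.card V - s := by
        rw [Finset.card_sdiff_of_subset (Finset.subset_univ _), hY.card_eq, Finset.card_univ]

lemma two_mul_card_le_of_large [Fintype V] (h : CliqueSystem s H F)
    (hlarge : 2 ^ (s + 2) * ((s + 10) * (s + 1)) + 1 < F.card) :
    2 * F.card ≤ Fintype.card V - s := by
  obtain ⟨S, hS⟩ := Finset.card_pos.1 (show 0 < F.card by omega)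
  have hex : ∀ T ∈ F.erase S, ∃ K, K ⊆ S ∩ T ∧ H.IsNClique s K := fun T hT =>
    h.inter S hS T (mem_of_mem_erase hT) (ne_of_mem_erase hT).symm
  choose! f hf using hex
  obtain ⟨Y, -, hYc⟩ := Finset.exists_lt_card_fiber_of_mul_lt_card_of_maps_to
    (s := F.erase S) (t := S.powerset) (f := f) (n := (s + 10) * (s + 1))
    (fun T hT => mem_powerset.2 ((hf T hT).1.trans Finset.inter_subset_left))
    (by rw [Finset.card_powerset, h.card_eq S hS, Finset.card_erase_of_mem hS]; omega)
  obtain ⟨T, hT⟩ := Finset.card_pos.1 (lt_of_le_of_lt (Nat.zero_le _) hYc)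
  obtain ⟨hT, hTY⟩ := mem_filter.1 hT
  refine h.two_mul_card_le (hTY ▸ (hf T hT).2) (lt_of_lt_of_le hYc (Finset.card_le_card ?_))
  intro U hU
  obtain ⟨hU, hUY⟩ := mem_filter.1 hU
  exact mem_filter.2
    ⟨mem_of_mem_erase hU, hUY ▸ (hf U hU).1.trans Finset.inter_subset_right⟩

end CliqueSystem

end Auxiliary

section Construction

/-- The join of a clique on `c` vertices with the disjoint union of one isolated vertex and a
complete bipartite graph minus a maximum matching. -/
def joinGraph (c m : ℕ) : SimpleGraph (Fin m) where
  Adj i j := i ≠ j ∧ ((i : ℕ) < c ∨ (j : ℕ) < c ∨ (c < (i : ℕ) ∧ c < (j : ℕ) ∧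
    (i : ℕ) % 2 ≠ (j : ℕ) % 2 ∧ ((i : ℕ) - c - 1) / 2 ≠ ((j : ℕ) - c - 1) / 2))
  symm := ⟨fun i j h => ⟨h.1.symm, by have := h.2; tauto⟩⟩
  loopless := ⟨fun i h => h.1 rfl⟩

/-- The first `c + 1` vertices together with the `p`-th matched pair. -/
def pairBlock (c m p : ℕ) : Finset (Fin m) :=
  univ.filter (fun i : Fin m => (i : ℕ) ≤ c ∨ ((i : ℕ) - c - 1) / 2 = p)

lemma card_fin_filter_lt {c m : ℕ} (hc : c ≤ m) :
    (univ.filter (fun i : Fin m => (i : ℕ) < c)).card = c := by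
  rw [Fin.card_filter_val_lt]; omega

lemma card_le_add_card_filter {c m : ℕ} (hc : c ≤ m) (K : Finset (Fin m)) :
    K.card ≤ c + (K.filter (fun i : Fin m => ¬ (i : ℕ) < c)).card := by
  rw [← Finset.card_filter_add_card_filter_not (s := K) (fun i : Fin m => (i : ℕ) < c)]
  gcongr
  calc _ ≤ (univ.filter (fun i : Fin m => (i : ℕ) < c)).card :=
        Finset.card_le_card (Finset.filter_subset_filter _ (Finset.subset_univ _))
    _ = c := card_fin_filter_lt hc

lemma cliqueSystem_joinGraph {c m : ℕ} (hc : c + 1 ≤ m) :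
    CliqueSystem (c + 1) (joinGraph c m)
      ((range ((m - c - 1) / 2)).image (pairBlock c m)) where
  cliqueFree K hK := by
    have h1 := card_le_add_card_filter (show c ≤ m by omega) K
    rw [hK.card_eq] at h1
    have h2 : (K.filter (fun i : Fin m => ¬ (i : ℕ) < c)).card ≤ (range 2).card := by
      apply Finset.card_le_card_of_injOn (fun i : Fin m => (i : ℕ) % 2)
      · intro i _
        simp only [coe_range, Set.mem_Iio]; omega
      · intro i hi j hj hij
        by_contra hne
        obtain ⟨hi, hi'⟩ := mem_filter.1 hi
        obtain ⟨hj, hj'⟩ := mem_filter.1 hj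
        have := (hK.isClique hi hj hne).2
        dsimp only at hij
        omega
    rw [card_range] at h2
    omega
  card_eq S hS := by
    obtain ⟨p, hp, rfl⟩ := mem_image.1 hS
    rw [mem_range] at hp
    have e : pairBlock c m p = insert ⟨c + 1 + 2 * p, by omega⟩ (insert ⟨c + 2 + 2 * p, by omega⟩
        (univ.filter (fun i : Fin m => (i : ℕ) < c + 1))) := by
      ext i
      simp only [pairBlock, mem_filter, mem_univ, true_and, mem_insert, Fin.ext_iff]
      omega
    rw [e, Finset.card_insert_of_notMem, Finset.card_insert_of_notMem, card_fin_filter_lt hc]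
    · simp only [mem_filter, mem_univ, true_and]; omega
    · simp only [mem_filter, mem_univ, true_and, mem_insert, Fin.ext_iff]; omega
  free S hS K hKS hK := by
    obtain ⟨p, hp, rfl⟩ := mem_image.1 hS
    have h1 := card_le_add_card_filter (show c ≤ m by omega) K
    rw [hK.card_eq] at h1
    have h2 : (K.filter (fun i : Fin m => ¬ (i : ℕ) < c)).card ≤ 1 := by
      rw [Finset.card_le_one]
      intro i hi j hj
      by_contra hne
      obtain ⟨hi, hi'⟩ := mem_filter.1 hi
      obtain ⟨hj, hj'⟩ := mem_filter.1 hj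
      have h3 := (hK.isClique hi hj hne).2
      have h4 := (mem_filter.1 (hKS hi)).2
      have h5 := (mem_filter.1 (hKS hj)).2
      omega
    omega
  dom S hS v hv := by
    obtain ⟨p, hp, rfl⟩ := mem_image.1 hS
    rw [mem_range] at hp
    simp only [pairBlock, mem_filter, mem_univ, true_and, not_or] at hv
    obtain ⟨w, hw, hwv⟩ : ∃ w : Fin m, ((w : ℕ) = c + 1 + 2 * p ∨ (w : ℕ) = c + 2 + 2 * p) ∧
        (v : ℕ) % 2 ≠ (w : ℕ) % 2 := by
      by_cases hpar : (v : ℕ) % 2 = (c + 1 + 2 * p) % 2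
      · exact ⟨⟨c + 2 + 2 * p, by omega⟩, Or.inr rfl, by dsimp only; omega⟩
      · exact ⟨⟨c + 1 + 2 * p, by omega⟩, Or.inl rfl, hpar⟩
    refine ⟨insert v (insert w (univ.filter (fun i : Fin m => (i : ℕ) < c))), ?_, ?_⟩
    · apply Finset.insert_subset_insert
      intro i hi
      simp only [pairBlock, mem_filter, mem_univ, true_and, mem_insert, Fin.ext_iff] at hi ⊢
      omega
    · constructor
      · intro i hi j hj hij
        refine ⟨hij, ?_⟩
        rw [Ne, Fin.ext_iff] at hij
        simp only [coe_insert, coe_filter, Set.mem_insert_iff, Set.mem_ofPred_eq, mem_univ,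
          true_and, Fin.ext_iff] at hi hj
        omega
      · rw [Finset.card_insert_of_notMem, Finset.card_insert_of_notMem,
          card_fin_filter_lt (by omega)]
        · simp only [mem_filter, mem_univ, true_and]; omega
        · simp only [mem_filter, mem_univ, true_and, mem_insert, Fin.ext_iff]; omega
  inter S hS T hT _ := by
    obtain ⟨p, -, rfl⟩ := mem_image.1 hS
    obtain ⟨q, -, rfl⟩ := mem_image.1 hT
    refine ⟨univ.filter (fun i : Fin m => (i : ℕ) < c + 1), ?_, ?_, card_fin_filter_lt hc⟩
    · intro i hi
      simp only [pairBlock, mem_filter, mem_univ, true_and, mem_inter] at hi ⊢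
      omega
    · intro i hi j hj hij
      refine ⟨hij, ?_⟩
      rw [Ne, Fin.ext_iff] at hij
      simp only [coe_filter, Set.mem_ofPred_eq, mem_univ, true_and] at hi hj
      omega

lemma card_image_pairBlock (c m : ℕ) :
    ((range ((m - c - 1) / 2)).image (pairBlock c m)).card = (m - c - 1) / 2 := by
  rw [Finset.card_image_of_injOn, card_range]
  intro p hp q _ hpq
  rw [mem_coe, mem_range] at hp
  have h1 : (⟨c + 1 + 2 * p, by omega⟩ : Fin m) ∈ pairBlock c m p := by
    simp only [pairBlock, mem_filter, mem_univ, true_and]; omega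
  rw [hpq] at h1
  simp only [pairBlock, mem_filter, mem_univ, true_and] at h1
  omega

end Construction

/-- For `r ≥ 3` and large `m`: `s_{r,r}(m) = ⌊(m-r+2)/2⌋`. -/
theorem stmt7 (r : ℕ) (hr : 3 ≤ r) :
    ∃ M : ℕ, ∀ m : ℕ, M ≤ m →
      (∀ (V : Type) [Fintype V] [DecidableEq V] (H : SimpleGraph V) (F : Finset (Finset V)),
        Fintype.card V = m → IsRTSystem r r H F → F.card ≤ (m - r + 2) / 2) ∧
      (∃ (H : SimpleGraph (Fin m)) (F : Finset (Finset (Fin m))),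
        IsRTSystem r r H F ∧ F.card = (m - r + 2) / 2) := by
  obtain ⟨c, rfl⟩ : ∃ c, r = c + 3 := ⟨r - 3, by omega⟩
  refine ⟨2 * (2 ^ (c + 3) * ((c + 11) * (c + 2)) + 1) + (c + 3), fun m hm => ⟨?_, ?_⟩⟩
  · intro V _ _ H F hV hF
    have hF := (isRTSystem_iff_cliqueSystem (c + 1) H F).1 hF
    by_cases hl : 2 ^ (c + 3) * ((c + 11) * (c + 2)) + 1 < F.card
    · have := hF.two_mul_card_le_of_large hl
      rw [hV] at this
      omega
    · omega
  · refine ⟨joinGraph c m, (range ((m - c - 1) / 2)).image (pairBlock c m),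
      (isRTSystem_iff_cliqueSystem (c + 1) _ _).2 (cliqueSystem_joinGraph (by omega)), ?_⟩
    rw [card_image_pairBlock]
    congr 1
    omega
end

section
/- For all integers r ≥ 3 and t ≥ r+2 there exist real constants c, C > 0 and an integer M such that for every integer m ≥ M: every (r,t)-system (H,F) with |H| = m satisfies |F| ≤ C·m^{t-r+2}, and there exists an (r,t)-system (H,F) with |H| = m and |F| ≥ c·m^{(t-r+2)/2}. -/
open SimpleGraph

theorem isRTSystem_iff {r t : ℕ} {V : Type*} [DecidableEq V] {H : SimpleGraph V}
    {F : Finset (Finset V)} :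
    IsRTSystem r t H F ↔ H.CliqueFree r ∧
      (∀ S ∈ F, S.card = t ∧ H.CliqueFreeOn (S : Set V) (r - 1) ∧
        ∀ v : V, v ∉ S → ¬ H.CliqueFreeOn ((insert v S : Finset V) : Set V) (r - 1)) ∧
      (∀ S ∈ F, ∀ T ∈ F, S ≠ T → ¬ H.CliqueFreeOn ((S ∩ T : Finset V) : Set V) (r - 2)) := by
  simp only [IsRTSystem, cliqueFree_induce_iff]

theorem not_cliqueFreeOn_iff {V : Type*} {H : SimpleGraph V} {S : Finset V} {n : ℕ} :
    ¬ H.CliqueFreeOn (S : Set V) n ↔ ∃ C ⊆ S, H.IsNClique n C := by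
  simp [CliqueFreeOn]

/-! ### Upper bound -/

theorem IsRTSystem.card_le {r t : ℕ} (hr : 3 ≤ r) (ht : r ≤ t) {V : Type*} [Fintype V]
    [DecidableEq V] {H : SimpleGraph V} {F : Finset (Finset V)} (h : IsRTSystem r t H F) :
    F.card ≤ t.choose (r - 2) * Fintype.card V ^ (t - r + 2) := by
  rw [isRTSystem_iff] at h
  obtain ⟨-, hS, hST⟩ := h
  obtain rfl | ⟨S₀, hS₀⟩ := F.eq_empty_or_nonempty
  · simp
  have hcover : F ⊆ Finset.image (fun p : Finset V × Finset V => p.1 ∪ p.2)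
      (S₀.powersetCard (r - 2) ×ˢ Finset.univ.powersetCard (t - r + 2)) := by
    intro T hT
    obtain ⟨D, hD, hDT, hcard⟩ : ∃ D ⊆ S₀, D ⊆ T ∧ D.card = r - 2 := by
      by_cases hne : S₀ = T
      · obtain ⟨D, hD, hcard⟩ := Finset.exists_subset_card_eq (s := T) (n := r - 2)
          (by rw [(hS T hT).1]; omega)
        exact ⟨D, hne ▸ hD, hD, hcard⟩
      · obtain ⟨C, hC, hcl⟩ := not_cliqueFreeOn_iff.1 (hST S₀ hS₀ T hT hne)
        exact ⟨C, hC.trans Finset.inter_subset_left, hC.trans Finset.inter_subset_right, hcl.2⟩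
    refine Finset.mem_image.2 ⟨(D, T \ D), ?_, Finset.union_sdiff_of_subset hDT⟩
    simp only [Finset.mem_product, Finset.mem_powersetCard, Finset.subset_univ, true_and]
    refine ⟨⟨hD, hcard⟩, ?_⟩
    rw [Finset.card_sdiff_of_subset hDT, hcard, (hS T hT).1]
    omega
  calc F.card ≤ _ := Finset.card_le_card hcover
    _ ≤ _ := Finset.card_image_le
    _ = t.choose (r - 2) * (Fintype.card V).choose (t - r + 2) := by
      rw [Finset.card_product, Finset.card_powersetCard, Finset.card_powersetCard, (hS S₀ hS₀).1,
        Finset.card_univ]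
    _ ≤ _ := Nat.mul_le_mul_left _ (Nat.choose_le_pow _ _)

/-! ### Transport and adding dominating vertices -/

theorem cliqueFreeOn_comap_symm_iff {V W : Type*} (e : V ≃ W) {H : SimpleGraph V} {S : Finset V}
    {n : ℕ} : (H.comap e.symm).CliqueFreeOn (S.map e.toEmbedding : Finset W) n ↔
      H.CliqueFreeOn (S : Set V) n := by
  rw [← not_iff_not, not_cliqueFreeOn_iff, not_cliqueFreeOn_iff]
  constructor
  · rintro ⟨C, hC, hcl, hcard⟩
    refine ⟨C.map e.symm.toEmbedding, ?_, ?_, by simpa using hcard⟩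
    · intro v hv
      obtain ⟨w, hw, rfl⟩ := Finset.mem_map.1 hv
      obtain ⟨u, hu, rfl⟩ := Finset.mem_map.1 (hC hw)
      simpa using hu
    · intro a ha b hb hab
      obtain ⟨a, haC, rfl⟩ := Finset.mem_map.1 (Finset.mem_coe.1 ha)
      obtain ⟨b, hbC, rfl⟩ := Finset.mem_map.1 (Finset.mem_coe.1 hb)
      exact hcl (Finset.mem_coe.2 haC) (Finset.mem_coe.2 hbC) fun h => hab (congrArg _ h)
  · rintro ⟨C, hC, hcl, hcard⟩
    refine ⟨C.map e.toEmbedding, Finset.map_subset_map.2 hC, ?_, by simpa using hcard⟩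
    intro a ha b hb hab
    obtain ⟨a, haC, rfl⟩ := Finset.mem_map.1 (Finset.mem_coe.1 ha)
    obtain ⟨b, hbC, rfl⟩ := Finset.mem_map.1 (Finset.mem_coe.1 hb)
    simpa using hcl (Finset.mem_coe.2 haC) (Finset.mem_coe.2 hbC) fun h => hab (congrArg _ h)

theorem IsRTSystem.comap_symm {r t : ℕ} {V W : Type*} [DecidableEq V] [DecidableEq W] (e : V ≃ W)
    {H : SimpleGraph V} {F : Finset (Finset V)} (h : IsRTSystem r t H F) :
    IsRTSystem r t (H.comap e.symm) (F.map (Finset.mapEmbedding e.toEmbedding).toEmbedding) := by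
  rw [isRTSystem_iff] at h ⊢
  obtain ⟨hfree, hS, hST⟩ := h
  refine ⟨?_, ?_, ?_⟩
  · exact hfree.comap ⟨(Iso.comap e.symm H).toCopy⟩
  · intro S' hS'
    obtain ⟨S, hSF, rfl⟩ := Finset.mem_map.1 hS'
    obtain ⟨h1, h2, h3⟩ := hS S hSF
    refine ⟨by simpa using h1, (cliqueFreeOn_comap_symm_iff e).2 h2, ?_⟩
    intro w hw
    obtain ⟨v, rfl⟩ := e.surjective w
    have hv : v ∉ S := fun hv => hw (Finset.mem_map_of_mem e.toEmbedding hv)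
    have := h3 v hv
    rwa [← cliqueFreeOn_comap_symm_iff e, Finset.map_insert] at this
  · intro S' hS' T' hT' hne
    obtain ⟨S, hSF, rfl⟩ := Finset.mem_map.1 hS'
    obtain ⟨T, hTF, rfl⟩ := Finset.mem_map.1 hT'
    have := hST S hSF T hTF fun h => hne (h ▸ rfl)
    rwa [← cliqueFreeOn_comap_symm_iff e, Finset.map_inter] at this

/-- The graph obtained from `H` by adding a vertex adjacent to all others. -/
def coneGraph {V : Type*} (H : SimpleGraph V) : SimpleGraph (Option V) where
  Adj a b := a ≠ b ∧ ∀ u ∈ a, ∀ v ∈ b, H.Adj u v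
  symm := ⟨fun _ _ h => ⟨h.1.symm, fun u hu v hv => (h.2 v hv u hu).symm⟩⟩
  loopless := ⟨fun _ h => h.1 rfl⟩

theorem cliqueFreeOn_coneGraph_insertNone_iff {V : Type*} {H : SimpleGraph V} {S : Finset V}
    {n : ℕ} : (coneGraph H).CliqueFreeOn (S.insertNone : Finset (Option V)) (n + 1) ↔
      H.CliqueFreeOn (S : Set V) n := by
  classical
  rw [← not_iff_not, not_cliqueFreeOn_iff, not_cliqueFreeOn_iff]
  constructor
  · rintro ⟨C, hC, hcl, hcard⟩
    have hle : n ≤ C.eraseNone.card := by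
      have := Finset.card_le_card (Finset.insertNone_eraseNone C ▸ Finset.subset_insert none C)
      rw [Finset.card_insertNone] at this
      omega
    obtain ⟨D, hD, hDcard⟩ := Finset.exists_subset_card_eq hle
    refine ⟨D, fun v hv => ?_, fun a ha b hb hab => ?_, hDcard⟩
    · simpa using hC (Finset.mem_eraseNone.1 (hD hv))
    · exact (hcl (Finset.mem_eraseNone.1 (hD ha)) (Finset.mem_eraseNone.1 (hD hb))
        (by simpa using hab)).2 a rfl b rfl
  · rintro ⟨C, hC, hcl, hcard⟩
    refine ⟨C.insertNone, Finset.insertNone.monotone hC, fun a ha b hb hab => ⟨hab, ?_⟩,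
      by simpa using hcard⟩
    rintro u rfl v rfl
    exact hcl (by simpa using ha) (by simpa using hb) (by simpa using hab)

theorem IsRTSystem.coneGraph {r t : ℕ} (hr : 3 ≤ r) {V : Type*} [DecidableEq V] [Fintype V]
    {H : SimpleGraph V} {F : Finset (Finset V)} (h : IsRTSystem r t H F) :
    IsRTSystem (r + 1) (t + 1) (coneGraph H) (F.map Finset.insertNone.toEmbedding) := by
  obtain ⟨r, rfl⟩ := Nat.exists_eq_add_of_le' hr
  rw [isRTSystem_iff] at h ⊢
  obtain ⟨hfree, hS, hST⟩ := h
  refine ⟨?_, ?_, ?_⟩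
  · have := (cliqueFreeOn_coneGraph_insertNone_iff (S := Finset.univ)).2
      (hfree.cliqueFreeOn (s := ((Finset.univ : Finset V) : Set V)))
    rwa [show (Finset.univ : Finset V).insertNone = Finset.univ from rfl, Finset.coe_univ,
      cliqueFreeOn_univ] at this
  · intro S' hS'
    obtain ⟨S, hSF, rfl⟩ := Finset.mem_map.1 hS'
    obtain ⟨h1, h2, h3⟩ := hS S hSF
    refine ⟨by simpa using h1, cliqueFreeOn_coneGraph_insertNone_iff.2 h2, ?_⟩
    rintro (_ | v) hv
    · simp at hv
    have := h3 v (by simpa using hv)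
    rw [← cliqueFreeOn_coneGraph_insertNone_iff] at this
    convert this using 3
    · ext (_ | a) <;> simp
    · omega
  · intro S' hS' T' hT' hne
    obtain ⟨S, hSF, rfl⟩ := Finset.mem_map.1 hS'
    obtain ⟨T, hTF, rfl⟩ := Finset.mem_map.1 hT'
    have := hST S hSF T hTF fun h => hne (h ▸ rfl)
    rw [← cliqueFreeOn_coneGraph_insertNone_iff] at this
    convert this using 3
    · ext (_ | a) <;> simp
    · omega

theorem Is3TSystem.isRTSystem {t : ℕ} {V : Type*} [DecidableEq V] {H : SimpleGraph V}
    {F : Finset (Finset V)} (h : Is3TSystem t H F) : IsRTSystem 3 t H F := by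
  rw [isRTSystem_iff]
  obtain ⟨hfree, hS, hST⟩ := h
  refine ⟨hfree, fun S hSF => ⟨(hS S hSF).1, ?_, fun v hv => ?_⟩, fun S hSF T hTF hne => ?_⟩
  · rw [cliqueFreeOn_two]
    exact fun a ha b hb _ => (hS S hSF).2.1 a ha b hb
  · obtain ⟨u, hu, huv⟩ := (hS S hSF).2.2 v hv
    rw [cliqueFreeOn_two]
    exact fun hp => hp (by simp) (by simp [hu]) huv.ne huv
  · obtain ⟨v, hv⟩ := hST S hSF T hTF hne
    exact not_cliqueFreeOn_iff.2 ⟨{v}, by simpa using hv, isNClique_one.2 ⟨v, rfl⟩⟩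

/-- There is an `(r, t)`-system on `m` vertices with `N` sets. -/
def HasRTSystem (r t m N : ℕ) : Prop :=
  ∃ (H : SimpleGraph (Fin m)) (F : Finset (Finset (Fin m))), IsRTSystem r t H F ∧ F.card = N

theorem IsRTSystem.hasRTSystem {r t : ℕ} {V : Type*} [DecidableEq V] [Fintype V]
    {H : SimpleGraph V} {F : Finset (Finset V)} (h : IsRTSystem r t H F) :
    HasRTSystem r t (Fintype.card V) F.card :=
  ⟨_, _, h.comap_symm (Fintype.equivFin V), by simp⟩

theorem HasRTSystem.add {t m N : ℕ} (h : HasRTSystem 3 t m N) (j : ℕ) :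
    HasRTSystem (3 + j) (t + j) (m + j) N := by
  induction j with
  | zero => exact h
  | succ j ih =>
    obtain ⟨H, F, hHF, rfl⟩ := ih
    simpa [← add_assoc] using (hHF.coneGraph (by omega)).hasRTSystem

/-! ### The triangle-free construction -/

/-- A blow-up of the cycle of length `k`, with parts `K × K`, where consecutive parts are joined
completely except for the incidences `y' = 2 * y + x * x'`. -/
def cycleBlowup (k : ℕ) (K : Type*) [Field K] (hk : 4 ≤ k) : SimpleGraph (ZMod k × K × K) where
  Adj u v :=
    (v.1 = u.1 + 1 ∧ v.2.2 ≠ 2 * u.2.2 + u.2.1 * v.2.1) ∨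
    (u.1 = v.1 + 1 ∧ u.2.2 ≠ 2 * v.2.2 + v.2.1 * u.2.1)
  symm := ⟨fun _ _ h => h.symm⟩
  loopless := ⟨fun u h => by
    have : Fact (1 < k) := ⟨by omega⟩
    simp at h⟩

theorem cliqueFree_cycleBlowup (k : ℕ) (K : Type*) [Field K] (hk : 4 ≤ k) :
    (cycleBlowup k K hk).CliqueFree 3 := by
  classical
  intro C hC
  obtain ⟨a, b, c, hab, hac, hbc, -⟩ := is3Clique_iff.1 hC
  have h1 : (1 : ZMod k) ≠ 0 := by
    have : Fact (1 < k) := ⟨by omega⟩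
    exact one_ne_zero
  have h3 : (3 : ZMod k) ≠ 0 := by
    intro h
    have := (ZMod.natCast_eq_zero_iff 3 k).1 (by exact_mod_cast h)
    have := Nat.le_of_dvd (by omega) this
    omega
  have hab' := hab.imp And.left And.left
  have hac' := hac.imp And.left And.left
  have hbc' := hbc.imp And.left And.left
  rcases hab' with h | h <;> rcases hac' with h' | h' <;> rcases hbc' with h'' | h'' <;> grind

theorem exists_cyclic_recurrence {k p : ℕ} [NeZero k] [Fact p.Prime] (hp : 2 ^ k < p)
    (x : ZMod k → ZMod p) :
    ∃ y : ZMod k → ZMod p, ∀ i, y (i + 1) = 2 * y i + x i * x (i + 1) := by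
  have hinj : Function.Injective fun (y : ZMod k → ZMod p) i => y (i + 1) - 2 * y i := by
    intro y z hyz
    have hstep (i) : (y - z) (i + 1) = 2 * (y - z) i := by
      have := congrFun hyz i
      simp only [Pi.sub_apply] at this ⊢
      linear_combination this
    have hiter (i : ZMod k) (n : ℕ) : (y - z) (i + n) = 2 ^ n * (y - z) i := by
      induction n with
      | zero => simp
      | succ n ih => rw [Nat.cast_succ, ← add_assoc, hstep, ih]; ring
    have hpow : (2 : ZMod p) ^ k - 1 ≠ 0 := by
      intro h
      have h1 : 1 < 2 ^ k := Nat.one_lt_two_pow (NeZero.ne k)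
      have : ((2 ^ k - 1 : ℕ) : ZMod p) = 0 := by
        rw [Nat.cast_sub h1.le]; simpa using h
      have := Nat.le_of_dvd (by omega) ((ZMod.natCast_eq_zero_iff _ _).1 this)
      omega
    funext i
    have h := hiter i k
    rw [ZMod.natCast_self, add_zero] at h
    have : (2 ^ k - 1) * (y - z) i = 0 := by linear_combination -h
    exact sub_eq_zero.1 ((mul_eq_zero.1 this).resolve_left hpow)
  obtain ⟨y, hy⟩ := Finite.surjective_of_injective hinj fun i => x i * x (i + 1)
  exact ⟨y, fun i => by linear_combination congrFun hy i⟩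

theorem eq_of_forall_not_adj_cycleBlowup {k : ℕ} {K : Type*} [Field K] (hk : 4 ≤ k)
    {x y : ZMod k → K} (hxy : ∀ i, y (i + 1) = 2 * y i + x i * x (i + 1))
    (hx : ∀ i j, 2 * x i + x j ≠ 0) (v : ZMod k × K × K)
    (hv : ∀ i, ¬ (cycleBlowup k K hk).Adj v (i, x i, y i)) : v = (v.1, x v.1, y v.1) := by
  obtain ⟨i, a, b⟩ := v
  have h1 : b = 2 * y (i - 1) + x (i - 1) * a := by
    by_contra h
    exact hv (i - 1) (Or.inr ⟨by simp, h⟩)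
  have h2 : y (i + 1) = 2 * b + a * x (i + 1) := by
    by_contra h
    exact hv (i + 1) (Or.inl ⟨rfl, h⟩)
  have h3 : y i = 2 * y (i - 1) + x (i - 1) * x i := by simpa using hxy (i - 1)
  have h4 := hxy i
  have : (a - x i) * (2 * x (i - 1) + x (i + 1)) = 0 := by
    linear_combination (-2) * h1 - h2 + 2 * h3 + h4
  have ha : a = x i := sub_eq_zero.1 ((mul_eq_zero.1 this).resolve_right (hx _ _))
  subst ha
  simp [h1, h3]

/-- The star with centre `none`. -/
def optionStar (W : Type*) : SimpleGraph (Option W) where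
  Adj a b := a.isNone ≠ b.isNone
  symm := ⟨fun _ _ h => h.symm⟩
  loopless := ⟨fun _ h => h rfl⟩

/-- Adding to a triangle-free graph a disjoint star whose centre belongs to all the sets. -/
theorem is3TSystem_sum_star {k : ℕ} {V W : Type*} [DecidableEq V] [DecidableEq W]
    {G : SimpleGraph V} (hG : G.CliqueFree 3) {F : Finset (Finset V)}
    (hF : ∀ S ∈ F, S.card = k ∧ (∀ u ∈ S, ∀ v ∈ S, ¬ G.Adj u v) ∧
      ∀ v, v ∉ S → ∃ u ∈ S, G.Adj v u) :
    Is3TSystem (k + 1) (G ⊕g optionStar W) (F.image fun S => S.disjSum {none}) := by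
  refine ⟨?_, ?_, ?_⟩
  · intro C hC
    obtain ⟨a, b, c, hab, hac, hbc, -⟩ := is3Clique_iff.1 hC
    rcases a with a | a <;> rcases b with b | b <;> rcases c with c | c <;>
      simp only [sum_adj_inl, sum_adj_inr, not_adj_sum_inl_inr] at hab hac hbc
    · exact hG _ (is3Clique_triple_iff.2 ⟨hab, hac, hbc⟩)
    all_goals first
      | exact not_adj_sum_inl_inr _ _ hab.symm
      | exact not_adj_sum_inl_inr _ _ hac.symm
      | skip
    rcases a with _ | a <;> rcases b with _ | b <;> rcases c with _ | c <;>
      simp_all [optionStar]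
  · intro S' hS'
    obtain ⟨S, hSF, rfl⟩ := Finset.mem_image.1 hS'
    obtain ⟨h1, h2, h3⟩ := hF S hSF
    refine ⟨by simp [Finset.card_disjSum, h1], ?_, ?_⟩
    · rintro (u | u) hu (v | v) hv
      · simpa using h2 u (by simpa using hu) v (by simpa using hv)
      · simp
      · simp
      · simp_all [optionStar]
    · rintro (v | v) hv
      · obtain ⟨u, hu, huv⟩ := h3 v (by simpa using hv)
        exact ⟨.inl u, by simpa using hu, by simpa using huv⟩
      · refine ⟨.inr none, by simp, ?_⟩
        cases v <;> simp_all [optionStar]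
  · intro S' hS' T' hT' _
    obtain ⟨S, hSF, rfl⟩ := Finset.mem_image.1 hS'
    obtain ⟨T, hTF, rfl⟩ := Finset.mem_image.1 hT'
    exact ⟨.inr none, by simp⟩

theorem hasRTSystem_three {k p q : ℕ} (hk : 4 ≤ k) (hp : p.Prime) (hkp : 2 ^ k < p)
    (hq : 3 * q < p) (l : ℕ) : HasRTSystem 3 (k + 1) (k * p ^ 2 + (l + 1)) (q ^ k) := by
  classical
  have : Fact p.Prime := ⟨hp⟩
  have : NeZero k := ⟨by omega⟩
  let X : (ZMod k → Fin q) → ZMod k → ZMod p := fun f i => ((f i : ℕ) + 1 : ℕ)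
  have hX (f i j) : 2 * X f i + X f j ≠ 0 := by
    intro h
    have h0 : ((2 * ((f i : ℕ) + 1) + ((f j : ℕ) + 1) : ℕ) : ZMod p) = 0 := by
      push_cast; simpa [X] using h
    have := Nat.le_of_dvd (by omega) ((ZMod.natCast_eq_zero_iff _ _).1 h0)
    omega
  have hXinj : Function.Injective X := by
    intro f g hfg
    funext i
    have h := congrFun hfg i
    have := Nat.ModEq.eq_of_lt_of_lt ((ZMod.natCast_eq_natCast_iff _ _ _).1 h)
      (by omega) (by omega)
    exact Fin.ext (by omega)
  choose Y hY using fun f => exists_cyclic_recurrence hkp (X f)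
  let S : (ZMod k → Fin q) → Finset (ZMod k × ZMod p × ZMod p) :=
    fun f => Finset.univ.image fun i => (i, X f i, Y f i)
  have hS {f v} : v ∈ S f ↔ v = (v.1, X f v.1, Y f v.1) := by
    simp only [S, Finset.mem_image, Finset.mem_univ, true_and]
    exact ⟨by rintro ⟨i, rfl⟩; rfl, fun h => ⟨v.1, h.symm⟩⟩
  have hSinj : Function.Injective S := by
    intro f g hfg
    refine hXinj (funext fun i => ?_)
    have : (i, X f i, Y f i) ∈ S g := hfg ▸ hS.2 rfl
    exact congrArg (fun v => v.2.1) (hS.1 this)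
  have hF : ∀ T ∈ Finset.univ.image S, T.card = k ∧
      (∀ u ∈ T, ∀ v ∈ T, ¬ (cycleBlowup k (ZMod p) hk).Adj u v) ∧
      ∀ v, v ∉ T → ∃ u ∈ T, (cycleBlowup k (ZMod p) hk).Adj v u := by
    intro T hT
    obtain ⟨f, -, rfl⟩ := Finset.mem_image.1 hT
    refine ⟨?_, ?_, ?_⟩
    · rw [Finset.card_image_of_injective _ fun i j h => congrArg Prod.fst h, Finset.card_univ,
        ZMod.card]
    · intro u hu v hv
      rw [hS.1 hu, hS.1 hv]
      rintro (⟨h, hne⟩ | ⟨h, hne⟩)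
      · exact hne (by simp only at h ⊢; rw [h, hY])
      · exact hne (by simp only at h ⊢; rw [h, hY])
    · intro v hv
      by_contra! hcon
      exact hv (hS.2 (eq_of_forall_not_adj_cycleBlowup hk (hY f) (hX f) v
        fun i => hcon _ (hS.2 rfl)))
  have h := (is3TSystem_sum_star (W := Fin l) (cliqueFree_cycleBlowup k _ hk)
    hF).isRTSystem.hasRTSystem
  rw [Finset.card_image_of_injective, Finset.card_image_of_injective _ hSinj] at h
  · simpa [ZMod.card, sq] using h
  · intro A B hAB
    ext a
    have := congrArg (Sum.inl a ∈ ·) hAB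
    simpa using this

theorem exists_hasRTSystem (r k : ℕ) (hr : 3 ≤ r) (hk : 4 ≤ k) :
    ∃ M : ℕ, ∀ m, M ≤ m → ∃ q, HasRTSystem r (k + r - 2) m (q ^ k) ∧ m ≤ 288 * k * q ^ 2 := by
  obtain ⟨j, rfl⟩ := Nat.exists_eq_add_of_le hr
  refine ⟨8 * k * (2 ^ k + 3) ^ 2 + 2 * (j + 1), fun m hm => ?_⟩
  set n := Nat.sqrt (m / (8 * k)) with hn
  have hle : 8 * k * n ^ 2 ≤ m :=
    (Nat.mul_le_mul_left _ (Nat.sqrt_le' _)).trans (Nat.mul_div_le _ _)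
  have hlt : m < 8 * k * (n + 1) ^ 2 := by
    have := Nat.lt_succ_sqrt' (m / (8 * k))
    rw [Nat.div_lt_iff_lt_mul (by omega)] at this
    rwa [mul_comm]
  have hbig : 2 ^ k + 3 ≤ n := by
    rw [hn, Nat.le_sqrt', Nat.le_div_iff_mul_le (by omega), mul_comm]
    omega
  have hk2 : 0 < 2 ^ k := by positivity
  obtain ⟨p, hp, hnp, hpn⟩ := Nat.exists_prime_lt_and_le_two_mul n (by omega)
  have hkp : k * p ^ 2 + (j + 1) ≤ m := by
    have h1 : k * p ^ 2 ≤ k * (2 * n) ^ 2 :=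
      Nat.mul_le_mul_left _ (Nat.pow_le_pow_left hpn 2)
    have h2 : k * (2 * n) ^ 2 * 2 = 8 * k * n ^ 2 := by ring
    omega
  have h := (hasRTSystem_three hk hp (q := (p - 1) / 3) (by omega) (by omega)
    (m - (k * p ^ 2 + (j + 1)))).add j
  refine ⟨(p - 1) / 3, ?_, hlt.le.trans ?_⟩
  · convert h using 1 <;> omega
  · have h1 : (n + 1) ^ 2 ≤ (6 * ((p - 1) / 3)) ^ 2 := Nat.pow_le_pow_left (by omega) 2
    calc 8 * k * (n + 1) ^ 2 ≤ 8 * k * (6 * ((p - 1) / 3)) ^ 2 := Nat.mul_le_mul_left _ h1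
      _ = _ := by ring

/-- For `r ≥ 3`, `t ≥ r+2`: `m^{(t-r+2)/2} ≪ s_{r,t}(m) ≪ m^{t-r+2}`. -/
theorem stmt9 (r t : ℕ) (hr : 3 ≤ r) (ht : r + 2 ≤ t) :
    ∃ c C : ℝ, 0 < c ∧ 0 < C ∧ ∃ M : ℕ, ∀ m : ℕ, M ≤ m →
      (∀ (V : Type) [Fintype V] [DecidableEq V] (H : SimpleGraph V) (F : Finset (Finset V)),
        Fintype.card V = m → IsRTSystem r t H F →
        (F.card : ℝ) ≤ C * (m : ℝ) ^ ((t : ℝ) - r + 2)) ∧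
      (∃ (H : SimpleGraph (Fin m)) (F : Finset (Finset (Fin m))),
        IsRTSystem r t H F ∧ c * (m : ℝ) ^ (((t : ℝ) - r + 2) / 2) ≤ (F.card : ℝ)) := by
  obtain ⟨k, rfl⟩ : ∃ k, t = k + r - 2 := ⟨t - r + 2, by omega⟩
  have hk : 4 ≤ k := by omega
  have hexp : ((k + r - 2 : ℕ) : ℝ) - r + 2 = (k : ℝ) := by
    rw [Nat.cast_sub (by omega)]; push_cast; ring
  obtain ⟨M, hM⟩ := exists_hasRTSystem r k hr hk
  have hpos : (0 : ℝ) < 288 * k := by positivity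
  refine ⟨((288 * k : ℝ) ^ ((k : ℝ) / 2))⁻¹, ((k + r - 2).choose (r - 2) : ℕ), by positivity,
    Nat.cast_pos.2 (Nat.choose_pos (by omega)), M, fun m hm => ⟨?_, ?_⟩⟩
  · intro V _ _ H F hV hHF
    have h := hHF.card_le hr (by omega)
    rw [hV, show k + r - 2 - r + 2 = k by omega] at h
    rw [hexp, Real.rpow_natCast]
    exact_mod_cast h
  · obtain ⟨q, ⟨H, F, hHF, hcard⟩, hq⟩ := hM m hm
    refine ⟨H, F, hHF, ?_⟩
    rw [hexp, hcard, inv_mul_le_iff₀ (by positivity)]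
    have hq' : (m : ℝ) ≤ 288 * k * (q : ℝ) ^ 2 := by exact_mod_cast hq
    calc (m : ℝ) ^ ((k : ℝ) / 2) ≤ (288 * k * (q : ℝ) ^ 2) ^ ((k : ℝ) / 2) :=
          Real.rpow_le_rpow (by positivity) hq' (by positivity)
      _ = _ := by
        rw [Real.mul_rpow hpos.le (by positivity), ← Real.rpow_natCast (q : ℝ) 2,
          ← Real.rpow_mul (by positivity)]
        push_cast
        rw [mul_div_cancel₀ _ (two_ne_zero' ℝ), Real.rpow_natCast]
end

section
/- For every integer t ≥ 1 there exists a real constant C > 0 such that for every integer m ≥ 0: s_{3,t}(m) ≤ s_{3,t+1}(m+1) ≤ C·m·s_{3,t}(m), where s_{3,k}(m) denotes the maximum of |F| over all (3,k)-systems (H,F) with |H| = m. -/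
open SimpleGraph

theorem Is3TSystem.card_le_s3 {t m : ℕ} {H : SimpleGraph (Fin m)}
    {F : Finset (Finset (Fin m))} (h : Is3TSystem t H F) : F.card ≤ s3 t m :=
  le_csSup ⟨Fintype.card (Finset (Fin m)), by rintro _ ⟨_, F, -, rfl⟩; exact F.card_le_univ⟩
    ⟨H, F, h, rfl⟩

theorem s3_le_of_forall {t m b : ℕ}
    (h : ∀ (H : SimpleGraph (Fin m)) (F : Finset (Finset (Fin m))),
      Is3TSystem t H F → F.card ≤ b) : s3 t m ≤ b := by
  apply csSup_le'
  rintro _ ⟨H, F, hF, rfl⟩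
  exact h H F hF

theorem cliqueFree_three_iff {V : Type*} {G : SimpleGraph V} :
    G.CliqueFree 3 ↔ ∀ a b c, G.Adj a b → G.Adj a c → ¬ G.Adj b c := by
  classical
  constructor
  · intro h a b c hab hac hbc
    exact h {a, b, c} (is3Clique_triple_iff.2 ⟨hab, hac, hbc⟩)
  · intro h s hs
    obtain ⟨a, b, c, hab, hac, hbc, -⟩ := is3Clique_iff.1 hs
    exact h a b c hab hac hbc

/-- Adding an isolated vertex, and putting it in every set, raises `t` by one. -/
theorem Is3TSystem.card_le_s3_succ {t m : ℕ} {H : SimpleGraph (Fin m)}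
    {F : Finset (Finset (Fin m))} (h : Is3TSystem t H F) :
    F.card ≤ s3 (t + 1) (m + 1) := by
  classical
  obtain ⟨hfree, hmax, -⟩ := h
  let φ : Finset (Fin m) → Finset (Fin (m + 1)) := fun S => insert 0 (S.map (Fin.succEmb m))
  have mem_zero (S : Finset (Fin m)) : (0 : Fin (m + 1)) ∈ φ S := by simp [φ]
  have mem_succ (S : Finset (Fin m)) (x : Fin m) : x.succ ∈ φ S ↔ x ∈ S := by
    simp [φ, Fin.succ_ne_zero]
  have inj : Function.Injective φ := by
    intro S T hST
    ext x
    rw [← mem_succ S, ← mem_succ T, hST]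
  have adj_succ (x y : Fin m) : (H.map (Fin.succEmb m)).Adj x.succ y.succ ↔ H.Adj x y :=
    SimpleGraph.map_adj_apply
  have adj_zero (y : Fin (m + 1)) : ¬ (H.map (Fin.succEmb m)).Adj 0 y := by
    rw [SimpleGraph.map_adj]
    rintro ⟨x, -, -, hx, -⟩
    exact Fin.succ_ne_zero x hx
  rw [← Finset.card_image_of_injective F inj]
  refine Is3TSystem.card_le_s3 (H := H.map (Fin.succEmb m)) ⟨?_, ?_, ?_⟩
  · rw [cliqueFree_three_iff] at hfree ⊢
    intro a b c hab hac hbc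
    cases a using Fin.cases with
    | zero => exact adj_zero _ hab
    | succ a =>
    cases b using Fin.cases with
    | zero => exact adj_zero _ hbc
    | succ b =>
    cases c using Fin.cases with
    | zero => exact adj_zero _ hbc.symm
    | succ c =>
    rw [adj_succ] at hab hac hbc
    exact hfree a b c hab hac hbc
  · intro S' hS'
    obtain ⟨S, hS, rfl⟩ := Finset.mem_image.1 hS'
    obtain ⟨hcard, hind, hdom⟩ := hmax S hS
    refine ⟨?_, ?_, ?_⟩
    · rw [Finset.card_insert_of_notMem (by simp [Fin.succ_ne_zero]), Finset.card_map, hcard]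
    · intro x hx y hy hxy
      cases x using Fin.cases with
      | zero => exact adj_zero _ hxy
      | succ x =>
      cases y using Fin.cases with
      | zero => exact adj_zero _ hxy.symm
      | succ y =>
      rw [mem_succ] at hx hy
      exact hind x hx y hy ((adj_succ x y).1 hxy)
    · intro x hx
      cases x using Fin.cases with
      | zero => exact absurd (mem_zero S) hx
      | succ x =>
      obtain ⟨y, hy, hxy⟩ := hdom x (by rwa [mem_succ] at hx)
      exact ⟨y.succ, (mem_succ S y).2 hy, (adj_succ x y).2 hxy⟩
  · rintro S' hS' T' hT' -
    obtain ⟨S, -, rfl⟩ := Finset.mem_image.1 hS'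
    obtain ⟨T, -, rfl⟩ := Finset.mem_image.1 hT'
    exact ⟨0, Finset.mem_inter.2 ⟨mem_zero S, mem_zero T⟩⟩

/-- The graph obtained from `H` by deleting `v` and turning every neighbour of `v` into a pendant
vertex attached to `u`. -/
def pendantGraph {m : ℕ} (H : SimpleGraph (Fin (m + 1))) (v : Fin (m + 1)) (u : Fin m) :
    SimpleGraph (Fin m) where
  Adj x y :=
    (¬ H.Adj v (v.succAbove x) ∧ ¬ H.Adj v (v.succAbove y) ∧
      H.Adj (v.succAbove x) (v.succAbove y)) ∨
    (H.Adj v (v.succAbove x) ∧ ¬ H.Adj v (v.succAbove y) ∧ y = u) ∨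
    (¬ H.Adj v (v.succAbove x) ∧ H.Adj v (v.succAbove y) ∧ x = u)
  symm := ⟨by
    rintro x y (⟨h1, h2, h3⟩ | ⟨h1, h2, h3⟩ | ⟨h1, h2, h3⟩)
    · exact Or.inl ⟨h2, h1, h3.symm⟩
    · exact Or.inr (Or.inr ⟨h2, h1, h3⟩)
    · exact Or.inr (Or.inl ⟨h2, h1, h3⟩)⟩
  loopless := ⟨by
    rintro x (⟨-, -, h⟩ | ⟨h, h', -⟩ | ⟨h', h, -⟩)
    · exact H.loopless.irrefl _ h
    · exact h' h
    · exact h' h⟩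

/-- Few sets of a `(3,t+1)`-system contain a given pair of vertices. -/
theorem Is3TSystem.card_filter_pair_le {t m : ℕ} {H : SimpleGraph (Fin (m + 1))}
    {F : Finset (Finset (Fin (m + 1)))} (h : Is3TSystem (t + 1) H F)
    (v : Fin (m + 1)) (u : Fin m) :
    (F.filter fun S => v ∈ S ∧ v.succAbove u ∈ S).card ≤ s3 t m := by
  classical
  obtain ⟨hfree, hmax, -⟩ := h
  let φ : Finset (Fin (m + 1)) → Finset (Fin m) :=
    fun S => Finset.univ.filter fun x => v.succAbove x ∈ S
  have mem_φ (S : Finset (Fin (m + 1))) (x : Fin m) : x ∈ φ S ↔ v.succAbove x ∈ S := by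
    simp [φ]
  have inj : Set.InjOn φ (F.filter fun S => v ∈ S ∧ v.succAbove u ∈ S) := by
    intro S hS T hT hST
    simp only [Finset.coe_filter, Set.mem_ofPred_eq] at hS hT
    ext x
    rcases Fin.eq_self_or_eq_succAbove v x with rfl | ⟨y, rfl⟩
    · simp [hS.2.1, hT.2.1]
    · rw [← mem_φ S, ← mem_φ T, hST]
  rw [← Finset.card_image_of_injOn inj]
  refine Is3TSystem.card_le_s3 (H := pendantGraph H v u) ⟨?_, ?_, ?_⟩
  · rw [cliqueFree_three_iff] at hfree ⊢
    intro a b c hab hac hbc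
    have := hfree (v.succAbove a) (v.succAbove b) (v.succAbove c)
    simp only [pendantGraph] at hab hac hbc
    grind
  · intro S' hS'
    obtain ⟨S, hS, rfl⟩ := Finset.mem_image.1 hS'
    obtain ⟨hSF, hv, hu⟩ := Finset.mem_filter.1 hS
    obtain ⟨hcard, hind, hdom⟩ := hmax S hSF
    refine ⟨?_, ?_, ?_⟩
    · have : S.erase v = (φ S).map v.succAboveEmb := by
        ext x
        rcases Fin.eq_self_or_eq_succAbove v x with rfl | ⟨y, rfl⟩
        · simp [Fin.succAbove_ne]
        · simp [mem_φ, Fin.succAbove_ne]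
      rw [← Finset.card_map v.succAboveEmb, ← this, Finset.card_erase_of_mem hv, hcard,
        Nat.add_sub_cancel]
    · intro x hx y hy hxy
      rw [mem_φ] at hx hy
      rcases hxy with ⟨-, -, hxy⟩ | ⟨hxy, -, -⟩ | ⟨-, hxy, -⟩
      · exact hind _ hx _ hy hxy
      · exact hind _ hv _ hx hxy
      · exact hind _ hv _ hy hxy
    · intro x hx
      rw [mem_φ] at hx
      by_cases hvx : H.Adj v (v.succAbove x)
      · exact ⟨u, (mem_φ S u).2 hu, Or.inr (Or.inl ⟨hvx, hind _ hv _ hu, rfl⟩)⟩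
      · obtain ⟨y, hy, hxy⟩ := hdom _ hx
        rcases Fin.eq_self_or_eq_succAbove v y with rfl | ⟨y, rfl⟩
        · exact absurd hxy.symm hvx
        · exact ⟨y, (mem_φ S y).2 hy, Or.inl ⟨hvx, hind _ hv _ hy, hxy⟩⟩
  · rintro S' hS' T' hT' -
    obtain ⟨S, hS, rfl⟩ := Finset.mem_image.1 hS'
    obtain ⟨T, hT, rfl⟩ := Finset.mem_image.1 hT'
    exact ⟨u, Finset.mem_inter.2 ⟨(mem_φ S u).2 (Finset.mem_filter.1 hS).2.2,
      (mem_φ T u).2 (Finset.mem_filter.1 hT).2.2⟩⟩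

theorem Is3TSystem.card_le_mul {t m : ℕ} (ht : 1 ≤ t) {H : SimpleGraph (Fin (m + 1))}
    {F : Finset (Finset (Fin (m + 1)))} (h : Is3TSystem (t + 1) H F) :
    F.card ≤ (t + 1) * m * s3 t m := by
  classical
  rcases F.eq_empty_or_nonempty with rfl | ⟨S₀, hS₀⟩
  · simp
  have hcard₀ := (h.2.1 S₀ hS₀).1
  have cover : F ⊆ (S₀ ×ˢ (Finset.univ : Finset (Fin m))).biUnion
      fun p => F.filter fun S => p.1 ∈ S ∧ p.1.succAbove p.2 ∈ S := by
    intro S hS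
    have hcard := (h.2.1 S hS).1
    obtain ⟨v, hv₀, hv⟩ : ∃ v ∈ S₀, v ∈ S := by
      by_cases hne : S₀ = S
      · subst hne
        obtain ⟨v, hv⟩ := Finset.card_pos.1 (by omega : 0 < S₀.card)
        exact ⟨v, hv, hv⟩
      · obtain ⟨v, hv⟩ := h.2.2 S₀ hS₀ S hS hne
        exact ⟨v, Finset.mem_inter.1 hv⟩
    obtain ⟨w, hw, hwv⟩ := Finset.exists_mem_ne (by omega : 1 < S.card) v
    obtain ⟨u, rfl⟩ := Fin.exists_succAbove_eq hwv
    exact Finset.mem_biUnion.2 ⟨(v, u), by simpa using hv₀, Finset.mem_filter.2 ⟨hS, hv, hw⟩⟩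
  refine (Finset.card_le_card cover).trans ((Finset.card_biUnion_le_card_mul _ _ (s3 t m)
    fun p _ => h.card_filter_pair_le p.1 p.2).trans_eq ?_)
  rw [Finset.card_product, hcard₀, Finset.card_univ, Fintype.card_fin]

/-- For `t ≥ 1`: `s_{3,t}(m) ≤ s_{3,t+1}(m+1) ≤ C · m · s_{3,t}(m)`. -/
theorem stmt11 (t : ℕ) (ht : 1 ≤ t) :
    ∃ C : ℝ, 0 < C ∧ ∀ m : ℕ,
      s3 t m ≤ s3 (t + 1) (m + 1) ∧
      (s3 (t + 1) (m + 1) : ℝ) ≤ C * (m : ℝ) * (s3 t m : ℝ) := by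
  refine ⟨(t + 1 : ℕ), by positivity, fun m => ⟨?_, ?_⟩⟩
  · exact s3_le_of_forall fun _ _ h => h.card_le_s3_succ
  · exact_mod_cast s3_le_of_forall fun _ _ h => h.card_le_mul ht
end
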